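/- (RCU-type achievability with minimum-distance decoding for the antisymmetric pair of BSCs.) For the CM-DMBC with 𝒳 = {1,2,3,4}, 𝒴 = {1,2}, where W₁ acts as a binary symmetric channel with crossover probability q₁ on inputs {1,2} (input 1 ↦ output 1 and input 2 ↦ output 2, each flipped with probability q₁) and as a BSC with crossover q₂ on inputs {3,4} (3 ↦ 1, 4 ↦ 2), and W₂ is the same with q₁ and q₂ interchanged: for every n ≥ 1 and M ≥ 1 there exists an (n, M, ε)-FLF code with ε ≤ Σ_{t=0}^n ℙ(Z₁^{(n)} = t)·min{ 1, (M−1)·Σ_{k=0}^t C(n,k)·2^{−n} }, where C(n,k) is the binomial coefficient and (Z₁^{(i)}, Z₂^{(i)}) is the random recursion: Z₁^{(0)} = Z₂^{(0)} = 0 and, for i = 1,…,n, if Z₁^{(i−1)} > Z₂^{(i−1)}, or Z₁^{(i−1)} = Z₂^{(i−1)} and Z̄^{(i)} = 0, then Z₁^{(i)} = Z₁^{(i−1)} + E₁^{(i)} and Z₂^{(i)} = Z₂^{(i−1)} + E₂^{(i)}; otherwise Z₁^{(i)} = Z₁^{(i−1)} + E₂^{(i)} and Z₂^{(i)} = Z₂^{(i−1)}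 + E₁^{(i)}; here E_k^{(i)} ∼ Bernoulli(q_k) and Z̄^{(i)} ∼ Bernoulli(1/2) are all mutually independent. -/

import Mathlib

open Finset

noncomputable section

/-- The pair of antisymmetric binary symmetric channels of Fig. 2:
inputs `{0,1}` go through a BSC with crossover `q1` (`0 ↦ 0`, `1 ↦ 1`),
inputs `{2,3}` through a BSC with crossover `q2` (`2 ↦ 0`, `3 ↦ 1`). -/
def Wbsc (q1 q2 : ℝ) : Fin 4 → Fin 2 → ℝ := fun x y =>
  if x = 0 then (if y = 0 then 1 - q1 else q1)
  else if x = 1 then (if y = 1 then 1 - q1 else q1)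
  else if x = 2 then (if y = 0 then 1 - q2 else q2)
  else (if y = 1 then 1 - q2 else q2)

/-- Causality of a feedback encoder. -/
def Causal (n M : ℕ) (f : Fin M → (Fin n → Fin 2) → (Fin n → Fin 2) → Fin n → Fin 4) :
    Prop :=
  ∀ (j : Fin M) (y1 y1' y2 y2' : Fin n → Fin 2) (i : Fin n),
    (∀ t, t < i → y1 t = y1' t) → (∀ t, t < i → y2 t = y2' t) →
      f j y1 y2 i = f j y1' y2' i

/-- The joint law of `(J, Y₁ⁿ, Y₂ⁿ)` for a (possibly randomized) FLF code whose
encoder uses the seed `s` distributed according to `μ`. -/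
def codeLawR (q1 q2 : ℝ) (n M R : ℕ) (μ : Fin R → ℝ)
    (f : Fin R → Fin M → (Fin n → Fin 2) → (Fin n → Fin 2) → Fin n → Fin 4)
    (j : Fin M) (y1 y2 : Fin n → Fin 2) : ℝ :=
  (1 / M) * ∑ s, μ s *
    ∏ i, (Wbsc q1 q2 (f s j y1 y2 i) (y1 i) * Wbsc q2 q1 (f s j y1 y2 i) (y2 i))

/-- Error probability at decoder 1. -/
def errProbR1 (q1 q2 : ℝ) (n M R : ℕ) (μ : Fin R → ℝ)
    (f : Fin R → Fin M → (Fin n → Fin 2) → (Fin n → Fin 2) → Fin n → Fin 4)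
    (g : (Fin n → Fin 2) → Fin M) : ℝ :=
  ∑ j, ∑ y1 : Fin n → Fin 2, ∑ y2 : Fin n → Fin 2,
    if g y1 = j then 0 else codeLawR q1 q2 n M R μ f j y1 y2

/-- Error probability at decoder 2. -/
def errProbR2 (q1 q2 : ℝ) (n M R : ℕ) (μ : Fin R → ℝ)
    (f : Fin R → Fin M → (Fin n → Fin 2) → (Fin n → Fin 2) → Fin n → Fin 4)
    (g : (Fin n → Fin 2) → Fin M) : ℝ :=
  ∑ j, ∑ y1 : Fin n → Fin 2, ∑ y2 : Fin n → Fin 2,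
    if g y2 = j then 0 else codeLawR q1 q2 n M R μ f j y1 y2

/-- One step weight of the triple `(E₁, E₂, Z̄)`:
`E₁ ∼ Bern(q1)`, `E₂ ∼ Bern(q2)`, `Z̄ ∼ Bern(1/2)`, independent. -/
def tripleW (q1 q2 : ℝ) (e : Bool × Bool × Bool) : ℝ :=
  (if e.1 then q1 else 1 - q1) * (if e.2.1 then q2 else 1 - q2) * (1 / 2)

/-- The random recursion `(Z₁^{(i)}, Z₂^{(i)})` driven by the triples
`(E₁^{(i)}, E₂^{(i)}, Z̄^{(i)})`. -/
def Zwalk (ω : ℕ → Bool × Bool × Bool) : ℕ → ℕ × ℕ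
  | 0 => (0, 0)
  | i + 1 =>
      let z := Zwalk ω i
      let e := ω i
      if z.1 > z.2 ∨ (z.1 = z.2 ∧ e.2.2 = false) then
        (z.1 + (if e.1 then 1 else 0), z.2 + (if e.2.1 then 1 else 0))
      else
        (z.1 + (if e.2.1 then 1 else 0), z.2 + (if e.1 then 1 else 0))

/-- The probability mass function of `Z₁^{(n)}`. -/
def Zpmf (q1 q2 : ℝ) (n t : ℕ) : ℝ :=
  ∑ ω : Fin n → Bool × Bool × Bool,
    if (Zwalk (fun i => if h : i < n then ω ⟨i, h⟩ else (false, false, false)) n).1 = t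
    then ∏ i, tripleW q1 q2 (ω i) else 0

/-- The number of ones of `a` strictly before time `k`. -/
def onesBefore {n : ℕ} (a : Fin n → Bool) (k : ℕ) : ℕ :=
  #{t : Fin n | t.val < k ∧ a t = true}

/-- The decision of the feedback encoder at time `i`: user 1 is served by the `q1` channel iff
it has seen more flips so far, ties being broken by the seed. Here `x i` holds the two
noise bits and the seed bit at time `i`. -/
def FirstGetsQ1 {n : ℕ} (x : Fin n → Bool × Bool × Bool) (i : Fin n) : Prop :=
  onesBefore (fun t => (x t).1) i > onesBefore (fun t => (x t).2.1) i ∨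
    (onesBefore (fun t => (x t).1) i = onesBefore (fun t => (x t).2.1) i ∧ (x i).2.2 = false)

open Classical in
/-- The driving triples `(E₁, E₂, Z̄)` that produce given noise words and seed. -/
def drivingTriples {n : ℕ} (x : Fin n → Bool × Bool × Bool) : Fin n → Bool × Bool × Bool :=
  fun i => if FirstGetsQ1 x i then x i else ((x i).2.1, (x i).1, (x i).2.2)

/-- The probability of the noise words and seed `x` under the feedback scheme. -/
def noiseLaw (q1 q2 : ℝ) {n : ℕ} (x : Fin n → Bool × Bool × Bool) : ℝ :=
  ∏ i, tripleW q1 q2 (drivingTriples x i)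

/-- Flip the bits of `c` at the ones of `a`. -/
def flipWord {n : ℕ} (c : Fin n → Fin 2) (a : Fin n → Bool) : Fin n → Fin 2 :=
  fun i => if a i then 1 - c i else c i

/-- The noise words and seed seen when `c` is sent and `y1`, `y2` are received. -/
def noiseOf {n : ℕ} (c y1 y2 : Fin n → Fin 2) (s : Fin n → Bool) :
    Fin n → Bool × Bool × Bool :=
  fun i => (decide (y1 i ≠ c i), decide (y2 i ≠ c i), s i)

open Classical in
/-- The feedback encoder of the codebook `c`. -/
def feedbackEncoder {n M : ℕ} (c : Fin M → Fin n → Fin 2) (s : Fin n → Bool) (j : Fin M)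
    (y1 y2 : Fin n → Fin 2) (i : Fin n) : Fin 4 :=
  if FirstGetsQ1 (noiseOf (c j) y1 y2 s) i then (if c j i = 0 then 0 else 1)
  else (if c j i = 0 then 2 else 3)

lemma onesBefore_congr {n : ℕ} {a b : Fin n → Bool} {k : ℕ}
    (h : ∀ t : Fin n, t.val < k → a t = b t) : onesBefore a k = onesBefore b k := by
  unfold onesBefore
  congr 1
  ext t
  simp only [mem_filter, mem_univ, true_and]
  constructor <;> rintro ⟨h1, h2⟩ <;> simp_all

lemma onesBefore_succ {n : ℕ} (a : Fin n → Bool) (k : ℕ) (hk : k < n) :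
    onesBefore a (k + 1) = onesBefore a k + if a ⟨k, hk⟩ then 1 else 0 := by
  unfold onesBefore
  rw [Finset.card_filter, Finset.card_filter]
  have key : ∀ t : Fin n, (if t.val < k + 1 ∧ a t = true then 1 else 0 : ℕ) =
      (if t.val < k ∧ a t = true then 1 else 0) +
        if t = ⟨k, hk⟩ then (if a ⟨k, hk⟩ then 1 else 0) else 0 := by
    intro t
    by_cases h : t = ⟨k, hk⟩
    · subst h; simp
    · have h' : t.val ≠ k := fun h' => h (Fin.ext h')
      have : t.val < k + 1 ↔ t.val < k := by omega
      simp [h, this]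
  rw [Finset.sum_congr rfl fun t _ => key t, Finset.sum_add_distrib]
  simp

lemma onesBefore_le {n : ℕ} (a : Fin n → Bool) (k : ℕ) : onesBefore a k ≤ n :=
  (Finset.card_le_univ _).trans_eq (Fintype.card_fin n)

lemma firstGetsQ1_congr {n : ℕ} {x x' : Fin n → Bool × Bool × Bool} {i : Fin n}
    (h : ∀ t, t < i → x t = x' t) (hs : (x i).2.2 = (x' i).2.2) :
    FirstGetsQ1 x i ↔ FirstGetsQ1 x' i := by
  unfold FirstGetsQ1
  rw [onesBefore_congr (a := fun t => (x t).1) (b := fun t => (x' t).1)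
      (fun t ht => by simp [h t ht]),
    onesBefore_congr (a := fun t => (x t).2.1) (b := fun t => (x' t).2.1)
      (fun t ht => by simp [h t ht]), hs]

lemma drivingTriples_of_firstGetsQ1 {n : ℕ} {x : Fin n → Bool × Bool × Bool} {i : Fin n}
    (h : FirstGetsQ1 x i) : drivingTriples x i = x i := if_pos h

lemma drivingTriples_of_not_firstGetsQ1 {n : ℕ} {x : Fin n → Bool × Bool × Bool} {i : Fin n}
    (h : ¬ FirstGetsQ1 x i) : drivingTriples x i = ((x i).2.1, (x i).1, (x i).2.2) := if_neg h

lemma drivingTriples_seed {n : ℕ} (x : Fin n → Bool × Bool × Bool) (i : Fin n) :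
    (drivingTriples x i).2.2 = (x i).2.2 := by
  unfold drivingTriples
  split_ifs <;> rfl

lemma drivingTriples_bijective (n : ℕ) : Function.Bijective (drivingTriples (n := n)) := by
  rw [← Finite.injective_iff_bijective]
  intro x x' hxx
  funext ⟨i, hi⟩
  induction i using Nat.strong_induction_on with
  | _ i ih =>
    have hi' := congrFun hxx ⟨i, hi⟩
    have hs : (x ⟨i, hi⟩).2.2 = (x' ⟨i, hi⟩).2.2 := by
      rw [← drivingTriples_seed x, ← drivingTriples_seed x', hi']
    have hiff := firstGetsQ1_congr (x := x) (x' := x') (i := ⟨i, hi⟩)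
      (fun t ht => ih t.val ht t.isLt) hs
    by_cases h : FirstGetsQ1 x ⟨i, hi⟩
    · rwa [drivingTriples_of_firstGetsQ1 h, drivingTriples_of_firstGetsQ1 (hiff.1 h)] at hi'
    · rw [drivingTriples_of_not_firstGetsQ1 h,
        drivingTriples_of_not_firstGetsQ1 (mt hiff.2 h)] at hi'
      simp only [Prod.mk.injEq] at hi'
      exact Prod.ext hi'.2.1 (Prod.ext hi'.1 hi'.2.2)

lemma Zwalk_drivingTriples {n : ℕ} (x : Fin n → Bool × Bool × Bool) (k : ℕ) (hk : k ≤ n) :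
    Zwalk (fun i => if h : i < n then drivingTriples x ⟨i, h⟩ else (false, false, false)) k =
      (onesBefore (fun t => (x t).1) k, onesBefore (fun t => (x t).2.1) k) := by
  induction k with
  | zero => simp [Zwalk, onesBefore]
  | succ k ih =>
    have hk' : k < n := hk
    rw [Zwalk, ih hk'.le, onesBefore_succ _ k hk', onesBefore_succ _ k hk']
    simp only [hk', dif_pos]
    rw [drivingTriples_seed]
    by_cases h : FirstGetsQ1 x ⟨k, hk'⟩
    · rw [drivingTriples_of_firstGetsQ1 h]
      exact if_pos h
    · rw [drivingTriples_of_not_firstGetsQ1 h]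
      exact if_neg h

lemma Zpmf_eq_sum_noiseLaw (q1 q2 : ℝ) (n t : ℕ) :
    Zpmf q1 q2 n t = ∑ x : Fin n → Bool × Bool × Bool,
      if onesBefore (fun i => (x i).1) n = t then noiseLaw q1 q2 x else 0 := by
  unfold Zpmf
  refine (Function.Bijective.sum_comp (drivingTriples_bijective n) _).symm.trans ?_
  refine Finset.sum_congr rfl fun x _ => ?_
  rw [Zwalk_drivingTriples x n le_rfl]
  rfl

lemma sum_Zpmf_mul (q1 q2 : ℝ) (n : ℕ) (B : ℕ → ℝ) :
    ∑ t ∈ Finset.range (n + 1), Zpmf q1 q2 n t * B t =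
      ∑ x : Fin n → Bool × Bool × Bool,
        noiseLaw q1 q2 x * B (onesBefore (fun i => (x i).1) n) := by
  simp only [Zpmf_eq_sum_noiseLaw, Finset.sum_mul]
  rw [Finset.sum_comm]
  refine Finset.sum_congr rfl fun x _ => ?_
  have hx : onesBefore (fun i => (x i).1) n ∈ Finset.range (n + 1) :=
    Finset.mem_range_succ_iff.2 (onesBefore_le _ _)
  rw [Finset.sum_eq_single_of_mem _ hx]
  · simp
  · intro t _ ht
    simp [ht.symm]

lemma noiseLaw_nonneg {q1 q2 : ℝ} (hq1 : q1 ∈ Set.Icc (0 : ℝ) 1) (hq2 : q2 ∈ Set.Icc (0 : ℝ) 1)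
    {n : ℕ} (x : Fin n → Bool × Bool × Bool) : 0 ≤ noiseLaw q1 q2 x := by
  obtain ⟨h1, h1'⟩ := hq1
  obtain ⟨h2, h2'⟩ := hq2
  refine Finset.prod_nonneg fun i _ => ?_
  unfold tripleW
  refine mul_nonneg (mul_nonneg ?_ ?_) (by norm_num) <;> split_ifs <;> linarith

/-- Exchange the two users and complement the seed. -/
def swapUsers {n : ℕ} (x : Fin n → Bool × Bool × Bool) : Fin n → Bool × Bool × Bool :=
  fun i => ((x i).2.1, (x i).1, !(x i).2.2)

lemma swapUsers_involutive (n : ℕ) : Function.Involutive (swapUsers (n := n)) := by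
  intro x
  funext i
  simp [swapUsers]

lemma firstGetsQ1_swapUsers {n : ℕ} (x : Fin n → Bool × Bool × Bool) (i : Fin n) :
    FirstGetsQ1 (swapUsers x) i ↔ ¬ FirstGetsQ1 x i := by
  simp only [FirstGetsQ1, swapUsers]
  generalize onesBefore (fun t => (x t).1) i = a
  generalize onesBefore (fun t => (x t).2.1) i = b
  cases (x i).2.2 <;> simp <;> omega

lemma noiseLaw_swapUsers (q1 q2 : ℝ) {n : ℕ} (x : Fin n → Bool × Bool × Bool) :
    noiseLaw q1 q2 (swapUsers x) = noiseLaw q1 q2 x := by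
  refine Finset.prod_congr rfl fun i _ => ?_
  by_cases h : FirstGetsQ1 x i
  · rw [drivingTriples_of_firstGetsQ1 h, drivingTriples_of_not_firstGetsQ1
      (mt (firstGetsQ1_swapUsers x i).1 (not_not.2 h))]
    rfl
  · rw [drivingTriples_of_not_firstGetsQ1 h, drivingTriples_of_firstGetsQ1
      ((firstGetsQ1_swapUsers x i).2 h)]
    rfl

lemma sum_noiseLaw_swap (q1 q2 : ℝ) {n : ℕ} (D : (Fin n → Bool) → Prop) [DecidablePred D] :
    (∑ x : Fin n → Bool × Bool × Bool,
      if D (fun i => (x i).2.1) then 0 else noiseLaw q1 q2 x) =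
    ∑ x : Fin n → Bool × Bool × Bool,
      if D (fun i => (x i).1) then 0 else noiseLaw q1 q2 x := by
  refine (Function.Bijective.sum_comp (swapUsers_involutive n).bijective _).symm.trans ?_
  refine Finset.sum_congr rfl fun x _ => ?_
  rw [noiseLaw_swapUsers]
  rfl

/-- For a fixed codeword, received words and seeds correspond to noise words and seeds. -/
def noiseEquiv {n : ℕ} (c : Fin n → Fin 2) :
    (Fin n → Fin 2) × (Fin n → Fin 2) × (Fin n → Bool) ≃ (Fin n → Bool × Bool × Bool) where
  toFun p := noiseOf c p.1 p.2.1 p.2.2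
  invFun x := (flipWord c fun i => (x i).1, flipWord c fun i => (x i).2.1, fun i => (x i).2.2)
  left_inv := by
    have key : ∀ u v : Fin 2, (if u = v then u else 1 - u) = v := by decide
    have key' : ∀ y : Fin n → Fin 2, (flipWord c fun i => decide (y i ≠ c i)) = y := by
      intro y
      funext i
      have := key (c i) (y i)
      simp only [flipWord, decide_eq_true_eq, ne_eq, ite_not, eq_comm (a := y i)]
      exact this
    rintro ⟨y1, y2, s⟩
    simp only [noiseOf, key']
  right_inv := by
    have key : ∀ (u : Fin 2) (b : Bool), decide ((if b then 1 - u else u) ≠ u) = b := by decide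
    intro x
    funext i
    exact Prod.ext (key _ _) (Prod.ext (key _ _) rfl)

lemma Wbsc_feedbackEncoder (q1 q2 : ℝ) {n M : ℕ} (c : Fin M → Fin n → Fin 2)
    (s : Fin n → Bool) (j : Fin M) (y1 y2 : Fin n → Fin 2) (i : Fin n) :
    Wbsc q1 q2 (feedbackEncoder c s j y1 y2 i) (y1 i) *
        Wbsc q2 q1 (feedbackEncoder c s j y1 y2 i) (y2 i) * (1 / 2) =
      tripleW q1 q2 (drivingTriples (noiseOf (c j) y1 y2 s) i) := by
  unfold feedbackEncoder drivingTriples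
  by_cases h : FirstGetsQ1 (noiseOf (c j) y1 y2 s) i
  · simp only [h, if_true, noiseOf]
    generalize c j i = u
    generalize y1 i = v
    generalize y2 i = w
    fin_cases u <;> fin_cases v <;> fin_cases w <;> simp [Wbsc, tripleW]
  · simp only [h, if_false, noiseOf]
    generalize c j i = u
    generalize y1 i = v
    generalize y2 i = w
    fin_cases u <;> fin_cases v <;> fin_cases w <;> simp [Wbsc, tripleW] <;> ring

lemma feedbackEncoder_causal {n M : ℕ} (c : Fin M → Fin n → Fin 2) (s : Fin n → Bool) :
    Causal n M (feedbackEncoder c s) := by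
  intro j y1 y1' y2 y2' i h1 h2
  unfold feedbackEncoder
  rw [firstGetsQ1_congr (x := noiseOf (c j) y1 y2 s) (x' := noiseOf (c j) y1' y2' s)]
  · intro t ht
    simp [noiseOf, h1 t ht, h2 t ht]
  · rfl

lemma sum_codeLawR_feedbackEncoder (q1 q2 : ℝ) {n M R : ℕ} (e : Fin R ≃ (Fin n → Bool))
    (c : Fin M → Fin n → Fin 2) (j : Fin M) (D : (Fin n → Fin 2) → (Fin n → Fin 2) → Prop)
    [∀ y1 y2, Decidable (D y1 y2)] :
    (∑ y1 : Fin n → Fin 2, ∑ y2 : Fin n → Fin 2, if D y1 y2 then 0 else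
      codeLawR q1 q2 n M R (fun _ => (1 / 2) ^ n) (fun s => feedbackEncoder c (e s)) j y1 y2) =
    1 / M * ∑ x : Fin n → Bool × Bool × Bool,
      if D (flipWord (c j) fun i => (x i).1) (flipWord (c j) fun i => (x i).2.1) then 0
      else noiseLaw q1 q2 x := by
  have hlaw : ∀ y1 y2 : Fin n → Fin 2,
      codeLawR q1 q2 n M R (fun _ => (1 / 2) ^ n) (fun s => feedbackEncoder c (e s)) j y1 y2 =
        1 / M * ∑ s : Fin n → Bool, noiseLaw q1 q2 (noiseOf (c j) y1 y2 s) := by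
    intro y1 y2
    unfold codeLawR
    congr 1
    rw [← Equiv.sum_comp e]
    refine Finset.sum_congr rfl fun s _ => ?_
    simp only [noiseLaw, ← Wbsc_feedbackEncoder, Finset.prod_mul_distrib, Finset.prod_const,
      Finset.card_univ, Fintype.card_fin]
    ring
  rw [← Equiv.sum_comp (noiseEquiv (c j)), Fintype.sum_prod_type, Finset.mul_sum]
  refine Finset.sum_congr rfl fun y1 _ => ?_
  rw [Fintype.sum_prod_type, Finset.mul_sum]
  refine Finset.sum_congr rfl fun y2 _ => ?_
  have h1 : ∀ s, (flipWord (c j) fun i => (noiseEquiv (c j) (y1, y2, s) i).1) = y1 := fun s =>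
    congrArg Prod.fst ((noiseEquiv (c j)).symm_apply_apply (y1, y2, s))
  have h2 : ∀ s, (flipWord (c j) fun i => (noiseEquiv (c j) (y1, y2, s) i).2.1) = y2 := fun s =>
    congrArg (fun p => p.2.1) ((noiseEquiv (c j)).symm_apply_apply (y1, y2, s))
  simp only [h1, h2, hlaw]
  split_ifs
  · simp
  · rfl

lemma errProbR1_feedbackEncoder (q1 q2 : ℝ) {n M R : ℕ} (e : Fin R ≃ (Fin n → Bool))
    (c : Fin M → Fin n → Fin 2) (g : (Fin n → Fin 2) → Fin M) :
    errProbR1 q1 q2 n M R (fun _ => (1 / 2) ^ n) (fun s => feedbackEncoder c (e s)) g =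
      ∑ j, 1 / (M : ℝ) * ∑ x : Fin n → Bool × Bool × Bool,
        if g (flipWord (c j) fun i => (x i).1) = j then 0 else noiseLaw q1 q2 x :=
  Finset.sum_congr rfl fun j _ =>
    sum_codeLawR_feedbackEncoder q1 q2 e c j fun y1 _ => g y1 = j

lemma errProbR2_eq_errProbR1 (q1 q2 : ℝ) {n M R : ℕ} (e : Fin R ≃ (Fin n → Bool))
    (c : Fin M → Fin n → Fin 2) (g : (Fin n → Fin 2) → Fin M) :
    errProbR2 q1 q2 n M R (fun _ => (1 / 2) ^ n) (fun s => feedbackEncoder c (e s)) g =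
      errProbR1 q1 q2 n M R (fun _ => (1 / 2) ^ n) (fun s => feedbackEncoder c (e s)) g := by
  rw [errProbR1_feedbackEncoder]
  refine Finset.sum_congr rfl fun j _ => ?_
  rw [sum_codeLawR_feedbackEncoder q1 q2 e c j fun _ y2 => g y2 = j,
    sum_noiseLaw_swap q1 q2 fun a => g (flipWord (c j) a) = j]

lemma hammingDist_flipWord {n : ℕ} (c : Fin n → Fin 2) (a : Fin n → Bool) :
    hammingDist c (flipWord c a) = onesBefore a n := by
  have key : ∀ (u : Fin 2) (b : Bool), u ≠ (if b then 1 - u else u) ↔ b = true := by decide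
  unfold hammingDist onesBefore
  congr 1
  ext t
  simp only [mem_filter, mem_univ, true_and, flipWord, key, t.isLt]

lemma card_hammingBall_le {n : ℕ} (w : Fin n → Fin 2) (t : ℕ) :
    #{u : Fin n → Fin 2 | hammingDist u w ≤ t} ≤ ∑ k ∈ Finset.range (t + 1), n.choose k := by
  have hinj : #{u : Fin n → Fin 2 | hammingDist u w ≤ t} ≤
      #{S : Finset (Fin n) | #S ≤ t} := by
    refine Finset.card_le_card_of_injOn
      (fun u => ({i | u i ≠ w i} : Finset (Fin n))) ?_ ?_
    · intro u hu
      simpa [hammingDist] using hu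
    · have key : ∀ u v w : Fin 2, (u ≠ w ↔ v ≠ w) → u = v := by decide
      intro u _ v _ huv
      funext i
      have := Finset.ext_iff.1 huv i
      simp only [mem_filter, mem_univ, true_and] at this
      exact key _ _ _ this
  refine hinj.trans (le_of_eq ?_)
  rw [Finset.card_eq_sum_card_fiberwise (f := Finset.card) (t := Finset.range (t + 1))]
  · refine Finset.sum_congr rfl fun k hk => ?_
    have : ({S ∈ ({S : Finset (Fin n) | #S ≤ t} : Finset (Finset (Fin n))) | #S = k}) =
        Finset.powersetCard k univ := by
      ext S
      simp only [mem_filter, mem_univ, true_and, mem_powersetCard, subset_univ]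
      rw [Finset.mem_range] at hk
      omega
    rw [this, Finset.card_powersetCard, Finset.card_univ, Fintype.card_fin]
  · intro S hS
    simp only [coe_filter, mem_univ, true_and, Set.mem_ofPred_eq] at hS
    simpa [Nat.lt_succ_iff] using hS

lemma card_codebooks_close_pair_le {n M : ℕ} {j j' : Fin M} (hj : j ≠ j') (a : Fin n → Bool)
    (t : ℕ) :
    (#{c : Fin M → Fin n → Fin 2 | hammingDist (c j') (flipWord (c j) a) ≤ t} : ℝ) ≤
      Fintype.card (Fin M → Fin n → Fin 2) *
        ∑ k ∈ Finset.range (t + 1), (n.choose k : ℝ) * (1 / 2) ^ n := by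
  let E := Equiv.funSplitAt j' (Fin n → Fin 2)
  have hcard : Fintype.card (Fin M → Fin n → Fin 2) =
      2 ^ n * Fintype.card ({i // i ≠ j'} → Fin n → Fin 2) := by
    rw [Fintype.card_congr E, Fintype.card_prod]
    simp
  have hnat : #{c : Fin M → Fin n → Fin 2 | hammingDist (c j') (flipWord (c j) a) ≤ t} ≤
      Fintype.card ({i // i ≠ j'} → Fin n → Fin 2) *
        ∑ k ∈ Finset.range (t + 1), n.choose k := by
    rw [Finset.card_filter, ← Equiv.sum_comp E.symm, Fintype.sum_prod_type_right]
    rw [← smul_eq_mul, ← Finset.card_univ, ← Finset.sum_const]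
    refine Finset.sum_le_sum fun r _ => ?_
    refine le_trans (le_of_eq ?_) (card_hammingBall_le (flipWord (r ⟨j, hj⟩) a) t)
    rw [Finset.card_filter]
    refine Finset.sum_congr rfl fun u _ => ?_
    have h1 : E.symm (u, r) j' = u := by simp [E, Equiv.funSplitAt, Equiv.piSplitAt]
    have h2 : E.symm (u, r) j = r ⟨j, hj⟩ := by simp [E, Equiv.funSplitAt, Equiv.piSplitAt, hj]
    rw [h1, h2]
  calc _ ≤ ((Fintype.card ({i // i ≠ j'} → Fin n → Fin 2) *
        ∑ k ∈ Finset.range (t + 1), n.choose k : ℕ) : ℝ) := by exact_mod_cast hnat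
    _ = _ := by
      rw [hcard, ← Finset.sum_mul]
      push_cast
      have : (2 : ℝ) ^ n * (1 / 2) ^ n = 1 := by rw [← mul_pow]; norm_num
      linear_combination (-(Fintype.card ({i // i ≠ j'} → Fin n → Fin 2) : ℝ) *
        ∑ k ∈ Finset.range (t + 1), (n.choose k : ℝ)) * this

lemma card_codebooks_decoding_error_le {n M : ℕ}
    (g : (Fin M → Fin n → Fin 2) → (Fin n → Fin 2) → Fin M)
    (hg : ∀ (c : Fin M → Fin n → Fin 2) y j, hammingDist (c (g c y)) y ≤ hammingDist (c j) y) (j : Fin M)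
    (a : Fin n → Bool) :
    (#{c : Fin M → Fin n → Fin 2 | g c (flipWord (c j) a) ≠ j} : ℝ) ≤
      Fintype.card (Fin M → Fin n → Fin 2) * min 1 (((M : ℝ) - 1) *
        ∑ k ∈ Finset.range (onesBefore a n + 1), (n.choose k : ℝ) * (1 / 2) ^ n) := by
  rw [mul_min_of_nonneg _ _ (Nat.cast_nonneg _)]
  refine le_min ?_ ?_
  · rw [mul_one]
    exact_mod_cast Finset.card_le_univ _
  · have hsub : ({c : Fin M → Fin n → Fin 2 | g c (flipWord (c j) a) ≠ j} : Finset _) ⊆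
        (univ.erase j).biUnion fun j' => {c : Fin M → Fin n → Fin 2 |
          hammingDist (c j') (flipWord (c j) a) ≤ onesBefore a n} := by
      intro c hc
      simp only [mem_filter, mem_univ, true_and] at hc
      simp only [mem_biUnion, mem_erase, mem_univ, and_true, mem_filter, true_and]
      exact ⟨_, hc, (hg c _ j).trans (hammingDist_flipWord _ _).le⟩
    have hM : ((#(univ.erase j) : ℕ) : ℝ) = (M : ℝ) - 1 := by
      rw [Finset.card_erase_of_mem (mem_univ _), Finset.card_univ, Fintype.card_fin,
        Nat.cast_sub (Nat.one_le_of_lt j.isLt), Nat.cast_one]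
    calc _ ≤ ((∑ j' ∈ univ.erase j, #{c : Fin M → Fin n → Fin 2 |
          hammingDist (c j') (flipWord (c j) a) ≤ onesBefore a n} : ℕ) : ℝ) := by
          exact_mod_cast (Finset.card_le_card hsub).trans Finset.card_biUnion_le
      _ ≤ ∑ j' ∈ univ.erase j, (Fintype.card (Fin M → Fin n → Fin 2) : ℝ) *
          ∑ k ∈ Finset.range (onesBefore a n + 1), (n.choose k : ℝ) * (1 / 2) ^ n := by
          rw [Nat.cast_sum]
          exact Finset.sum_le_sum fun j' hj' =>
            card_codebooks_close_pair_le (Finset.ne_of_mem_erase hj').symm a _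
      _ = _ := by
          rw [Finset.sum_const, nsmul_eq_mul, hM]
          ring

/-- **Theorem 5** (RCU-type achievability bound with minimum-distance decoding for
the antisymmetric pair of BSCs): there exists an `(n, M, ε)`-FLF code with
`ε ≤ Σ_t ℙ(Z₁^{(n)} = t) min{1, (M−1) Σ_{k ≤ t} C(n,k) 2^{−n}}`. -/
theorem bsc_rcu_achievability (q1 q2 : ℝ)
    (hq1 : q1 ∈ Set.Icc (0 : ℝ) 1) (hq2 : q2 ∈ Set.Icc (0 : ℝ) 1)
    (n M : ℕ) (hn : 1 ≤ n) (hM : 1 ≤ M) :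
    ∃ (R : ℕ) (μ : Fin R → ℝ), (∀ s, 0 ≤ μ s) ∧ (∑ s, μ s = 1) ∧
      ∃ f : Fin R → Fin M → (Fin n → Fin 2) → (Fin n → Fin 2) → Fin n → Fin 4,
        (∀ s, Causal n M (f s)) ∧
        ∃ g1 g2 : (Fin n → Fin 2) → Fin M,
          errProbR1 q1 q2 n M R μ f g1 ≤
            (∑ t ∈ Finset.range (n + 1), Zpmf q1 q2 n t *
              min 1 (((M : ℝ) - 1) *
                ∑ k ∈ Finset.range (t + 1), (n.choose k : ℝ) * (1 / 2) ^ n)) ∧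
          errProbR2 q1 q2 n M R μ f g2 ≤
            (∑ t ∈ Finset.range (n + 1), Zpmf q1 q2 n t *
              min 1 (((M : ℝ) - 1) *
                ∑ k ∈ Finset.range (t + 1), (n.choose k : ℝ) * (1 / 2) ^ n)) := by
  have : Nonempty (Fin M) := ⟨⟨0, hM⟩⟩
  have hg : ∀ (c : Fin M → Fin n → Fin 2) (y : Fin n → Fin 2),
      ∃ i, ∀ j, hammingDist (c i) y ≤ hammingDist (c j) y := fun c y => Finite.exists_min _
  choose g hg using hg
  let e : Fin (2 ^ n) ≃ (Fin n → Bool) := Fintype.equivOfCardEq (by simp)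
  let B : ℕ → ℝ := fun t => min 1 (((M : ℝ) - 1) *
    ∑ k ∈ Finset.range (t + 1), (n.choose k : ℝ) * (1 / 2) ^ n)
  obtain ⟨c, -, hc⟩ : ∃ c ∈ (univ : Finset (Fin M → Fin n → Fin 2)),
      errProbR1 q1 q2 n M (2 ^ n) (fun _ => (1 / 2) ^ n) (fun s => feedbackEncoder c (e s)) (g c) ≤
        ∑ t ∈ Finset.range (n + 1), Zpmf q1 q2 n t * B t := by
    refine Finset.exists_le_of_sum_le univ_nonempty ?_
    simp only [errProbR1_feedbackEncoder, sum_Zpmf_mul, Finset.sum_const, Finset.card_univ,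
      nsmul_eq_mul]
    rw [Finset.sum_comm]
    have hj : ∀ j : Fin M, ∑ c : Fin M → Fin n → Fin 2,
        1 / (M : ℝ) * (∑ x : Fin n → Bool × Bool × Bool,
          if g c (flipWord (c j) fun i => (x i).1) = j then 0 else noiseLaw q1 q2 x) ≤
        1 / (M : ℝ) * (Fintype.card (Fin M → Fin n → Fin 2) *
          ∑ x : Fin n → Bool × Bool × Bool,
            noiseLaw q1 q2 x * B (onesBefore (fun i => (x i).1) n)) := by
      intro j
      rw [← Finset.mul_sum]
      refine mul_le_mul_of_nonneg_left ?_ (by positivity)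
      rw [Finset.sum_comm, Finset.mul_sum]
      refine Finset.sum_le_sum fun x _ => ?_
      have hx := mul_le_mul_of_nonneg_left
        (card_codebooks_decoding_error_le g hg j fun i => (x i).1) (noiseLaw_nonneg hq1 hq2 x)
      rw [← Finset.sum_boole, Finset.mul_sum] at hx
      calc _ = _ := Finset.sum_congr rfl fun c _ => by split_ifs <;> simp_all
        _ ≤ _ := hx
        _ = _ := by ring
    refine (Finset.sum_le_sum fun j _ => hj j).trans (le_of_eq ?_)
    have hM0 : (M : ℝ) ≠ 0 := by positivity
    rw [Finset.sum_const, Finset.card_univ, Fintype.card_fin, nsmul_eq_mul]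
    field_simp
  refine ⟨2 ^ n, fun _ => (1 / 2) ^ n, fun _ => by positivity, ?_,
    fun s => feedbackEncoder c (e s), fun s => feedbackEncoder_causal c (e s), g c, g c, hc, ?_⟩
  · rw [Finset.sum_const, Finset.card_univ, Fintype.card_fin, nsmul_eq_mul, Nat.cast_pow,
      ← mul_pow]
    norm_num
  · rw [errProbR2_eq_errProbR1]
    exact hc
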